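/- arXiv:math/0312040 — 2 statements merged into one kernel-verified Lean document; each statement's English description precedes it below -/
import Mathlib

section
/- For n ≥ 2, the space of symmetric invariant bilinear forms on the Lie algebra gl(n,ℂ) of all complex n×n matrices is two-dimensional: the forms α₁(x,y) = tr(xy) and α₂(x,y) = tr(x)·tr(y) are symmetric and invariant, they are linearly independent, and every symmetric invariant bilinear form on gl(n,ℂ) is a linear combination a·α₁ + b·α₂ with a,b ∈ ℂ. -/
open Matrix

section InvariantForms

variable {ι K : Type*} [Fintype ι] [DecidableEq ι] [Field K]

lemma lie_single_single_diag (i j p : ι) :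
    ⁅(single i j 1 : Matrix ι ι K), (single p p 1 : Matrix ι ι K)⁆ =
      ((if j = p then 1 else 0) - (if i = p then 1 else 0) : K) • single i j 1 := by
  rw [Ring.lie_def, sub_smul]
  congr 1
  · split_ifs with h
    · subst h; simp
    · simp [h]
  · split_ifs with h
    · subst h; simp
    · simp [Ne.symm h]

lemma lie_single_diag_single (i j p : ι) :
    ⁅(single p p 1 : Matrix ι ι K), (single i j 1 : Matrix ι ι K)⁆ =
      ((if i = p then 1 else 0) - (if j = p then 1 else 0) : K) • single i j 1 := by
  rw [Ring.lie_def, ← neg_sub, ← Ring.lie_def, lie_single_single_diag, ← neg_smul, neg_sub]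

/-- An invariant form pairs matrix units of different weights under the diagonal matrices
trivially. -/
lemma invariantForm_single_eq_zero [CharZero K]
    (B : Matrix ι ι K →ₗ[K] Matrix ι ι K →ₗ[K] K)
    (hB : ∀ x y z, B ⁅x, y⁆ z = B x ⁅y, z⁆) {i j k l : ι}
    (hdiag : ¬(i = j ∧ k = l)) (hdual : ¬(j = k ∧ i = l)) :
    B (single i j 1) (single k l 1) = 0 := by
  by_contra hne
  have key (p : ι) : ((if j = p then 1 else 0) - (if i = p then 1 else 0) : K) =
      (if k = p then 1 else 0) - (if l = p then 1 else 0) := by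
    have h := hB (single i j 1) (single p p 1) (single k l 1)
    simp only [lie_single_single_diag, lie_single_diag_single, map_smul, LinearMap.smul_apply,
      smul_eq_mul] at h
    exact mul_right_cancel₀ hne h
  have hi := key i
  have hj := key j
  have hk := key k
  grind

/-- Invariance expresses differences of diagonal values through a dual pair of root vectors. -/
lemma invariantForm_single_diag_sub
    (B : Matrix ι ι K →ₗ[K] Matrix ι ι K →ₗ[K] K)
    (hB : ∀ x y z, B ⁅x, y⁆ z = B x ⁅y, z⁆) (i j k : ι) :
    B (single i i 1) (single k k 1) - B (single j j 1) (single k k 1) =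
      ((if i = k then 1 else 0) - (if j = k then 1 else 0)) *
        B (single i j 1) (single j i 1) := by
  have h := hB (single i j 1) (single j i 1) (single k k 1)
  have hlie : ⁅(single i j 1 : Matrix ι ι K), (single j i 1 : Matrix ι ι K)⁆ =
      single i i 1 - single j j 1 := by
    simp [Ring.lie_def]
  simpa only [hlie, lie_single_single_diag, map_sub, map_smul, LinearMap.sub_apply,
    smul_eq_mul] using h

lemma bilin_eq_trace_of_single
    (B : Matrix ι ι K →ₗ[K] Matrix ι ι K →ₗ[K] K) (a b : K)
    (h : ∀ i j k l, B (single i j 1) (single k l 1) =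
      a * trace ((single i j 1 : Matrix ι ι K) * single k l 1) +
        b * (trace (single i j 1 : Matrix ι ι K) * trace (single k l 1 : Matrix ι ι K)))
    (x y : Matrix ι ι K) :
    B x y = a * trace (x * y) + b * (trace x * trace y) := by
  let C : Matrix ι ι K →ₗ[K] Matrix ι ι K →ₗ[K] K :=
    LinearMap.mk₂ K (fun x y ↦ a * trace (x * y) + b * (trace x * trace y))
      (fun x y z ↦ by simp only [add_mul, trace_add]; ring)
      (fun c x y ↦ by simp only [Matrix.smul_mul, trace_smul, smul_eq_mul]; ring)
      (fun x y z ↦ by simp only [mul_add, trace_add]; ring)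
      (fun c x y ↦ by simp only [Matrix.mul_smul, trace_smul, smul_eq_mul]; ring)
  have hBC : B = C :=
    (Matrix.stdBasis K ι ι).ext fun ij ↦ (Matrix.stdBasis K ι ι).ext fun kl ↦ by
      rw [stdBasis_eq_single K ij.1 ij.2, stdBasis_eq_single K kl.1 kl.2]
      exact h _ _ _ _
  exact congrArg (fun D ↦ D x y) hBC

theorem exists_eq_trace_of_invariantForm [CharZero K] [Nontrivial ι]
    (B : Matrix ι ι K →ₗ[K] Matrix ι ι K →ₗ[K] K)
    (hsymm : ∀ x y, B x y = B y x) (hB : ∀ x y z, B ⁅x, y⁆ z = B x ⁅y, z⁆) :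
    ∃ a b : K, ∀ x y, B x y = a * trace (x * y) + b * (trace x * trace y) := by
  obtain ⟨p, q, hpq⟩ := exists_pair_ne ι
  have hsub := invariantForm_single_diag_sub B hB
  have hmove : ∀ i j k, i ≠ k → j ≠ k →
      B (single i i 1) (single k k 1) = B (single j j 1) (single k k 1) := by
    intro i j k hik hjk
    simpa [hik, hjk, sub_eq_zero] using hsub i j k
  have hoff : ∀ i k, i ≠ k →
      B (single i i 1) (single k k 1) = B (single p p 1) (single q q 1) := by
    intro i k hik
    by_cases hkp : k = p
    · subst hkp
      rw [hmove i q k hik hpq.symm, hsymm]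
    · rw [hmove i p k hik (Ne.symm hkp), hsymm, hmove k q p hkp hpq.symm, hsymm]
  have hdual : ∀ i j, i ≠ j → B (single i j 1) (single j i 1) =
      B (single i i 1) (single i i 1) - B (single p p 1) (single q q 1) := by
    intro i j hij
    have h := hsub i j i
    rw [hoff j i hij.symm] at h
    simpa [hij.symm] using h.symm
  have hdiag_eq : ∀ i, B (single i i 1) (single i i 1) = B (single p p 1) (single p p 1) := by
    intro i
    by_cases hip : i = p
    · rw [hip]
    · have h := hdual i p hip
      rw [hsymm, hdual p i (Ne.symm hip)] at h
      exact (sub_left_injective h).symm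
  refine ⟨B (single p p 1) (single p p 1) - B (single p p 1) (single q q 1),
    B (single p p 1) (single q q 1), bilin_eq_trace_of_single B _ _ fun i j k l ↦ ?_⟩
  by_cases h₁ : i = j ∧ k = l
  · obtain ⟨rfl, rfl⟩ := h₁
    by_cases hik : i = k
    · subst hik
      simp [hdiag_eq i]
    · simp [hoff i k hik, hik]
  · by_cases h₂ : j = k ∧ i = l
    · obtain ⟨rfl, rfl⟩ := h₂
      have hij : i ≠ j := fun h ↦ h₁ ⟨h, h.symm⟩
      simp [hdual i j hij, hdiag_eq i, hij]
    · rw [invariantForm_single_eq_zero B hB h₁ h₂]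
      by_cases hij : i = j <;> by_cases hjk : j = k <;> simp_all

end InvariantForms

/-- For `n ≥ 2`, the symmetric invariant bilinear forms on `gl(n,ℂ)` form a
two-dimensional space: `α₁(x,y) = tr(xy)` and `α₂(x,y) = tr(x)tr(y)` are symmetric and
invariant, linearly independent, and every symmetric invariant bilinear form is a linear
combination of them. -/
theorem gl_n_symmetric_invariant_bilinear_forms (n : ℕ) (hn : 2 ≤ n) :
    -- α₁ is symmetric and invariant,
    (∀ x y : Matrix (Fin n) (Fin n) ℂ, Matrix.trace (x * y) = Matrix.trace (y * x)) ∧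
    (∀ x y z : Matrix (Fin n) (Fin n) ℂ,
        Matrix.trace (⁅x, y⁆ * z) = Matrix.trace (x * ⁅y, z⁆)) ∧
    -- α₂ is symmetric and invariant,
    (∀ x y : Matrix (Fin n) (Fin n) ℂ,
        Matrix.trace x * Matrix.trace y = Matrix.trace y * Matrix.trace x) ∧
    (∀ x y z : Matrix (Fin n) (Fin n) ℂ,
        Matrix.trace ⁅x, y⁆ * Matrix.trace z = Matrix.trace x * Matrix.trace ⁅y, z⁆) ∧
    -- α₁ and α₂ are linearly independent,
    (∀ a b : ℂ,
        (∀ x y : Matrix (Fin n) (Fin n) ℂ,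
          a * Matrix.trace (x * y) + b * (Matrix.trace x * Matrix.trace y) = 0) →
        a = 0 ∧ b = 0) ∧
    -- and every symmetric invariant bilinear form is a linear combination a·α₁ + b·α₂.
    (∀ B : Matrix (Fin n) (Fin n) ℂ →ₗ[ℂ] Matrix (Fin n) (Fin n) ℂ →ₗ[ℂ] ℂ,
        (∀ x y : Matrix (Fin n) (Fin n) ℂ, B x y = B y x) →
        (∀ x y z : Matrix (Fin n) (Fin n) ℂ, B ⁅x, y⁆ z = B x ⁅y, z⁆) →
        ∃ a b : ℂ, ∀ x y : Matrix (Fin n) (Fin n) ℂ,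
          B x y = a * Matrix.trace (x * y) + b * (Matrix.trace x * Matrix.trace y)) := by
  have : Nontrivial (Fin n) := Fin.nontrivial_iff_two_le.2 hn
  refine ⟨trace_mul_comm, fun x y z ↦ ?_, fun x y ↦ mul_comm _ _, fun x y z ↦ ?_,
    fun a b h ↦ ?_, exists_eq_trace_of_invariantForm⟩
  · rw [Ring.lie_def, Ring.lie_def, sub_mul, mul_sub, trace_sub, trace_sub, mul_assoc,
      mul_assoc, trace_mul_comm y, mul_assoc]
  · simp [Ring.lie_def, trace_mul_comm x y, trace_mul_comm y z]
  · obtain ⟨p, q, hpq⟩ := exists_pair_ne (Fin n)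
    have ha : a = 0 := by simpa [hpq] using h (single p q 1) (single q p 1)
    have hb : b = 0 := by simpa [ha] using h (single p p 1) (single p p 1)
    exact ⟨ha, hb⟩
end

section
/- For n ≥ 2, every symmetric invariant bilinear form on the Lie algebra sl(n,ℂ) of trace-less complex n×n matrices is a scalar multiple of the trace form β(x,y) = tr(xy); i.e. the space of symmetric invariant bilinear forms on sl(n,ℂ) is one-dimensional, spanned by β. -/
open LieAlgebra.SpecialLinear

namespace Matrix

variable {m R : Type*} [Fintype m] [DecidableEq m] [CommRing R]

/-- Symmetric invariant bilinear forms on `gl` are spanned by `tr (X * Y)` and `tr X * tr Y`. -/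
theorem exists_eq_trace_mul_add_of_symm_of_invariant [Nontrivial m]
    (B : Matrix m m R →ₗ[R] Matrix m m R →ₗ[R] R)
    (hs : ∀ X Y, B X Y = B Y X)
    (hi : ∀ X Y Z, B (X * Y - Y * X) Z = B X (Y * Z - Z * Y)) :
    ∃ c d : R, ∀ X Y, B X Y = c * trace (X * Y) + d * (trace X * trace Y) := by
  obtain ⟨u, v, huv⟩ := exists_pair_ne m
  obtain ⟨b, hb⟩ : ∃ b : m → m → m → m → R,
      ∀ i j k l, B (single i j 1) (single k l 1) = b i j k l := ⟨_, fun _ _ _ _ => rfl⟩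
  have hmul : ∀ i j k l : m, single i j (1 : R) * single k l 1 =
      if j = k then single i l 1 else 0 := by
    intro i j k l
    split_ifs with h
    · subst h; simp
    · simp [h]
  have hsymm : ∀ i j k l, b i j k l = b k l i j := fun i j k l => by
    rw [← hb, ← hb, hs]
  have hinv : ∀ i j k l p q,
      (if j = k then b i l p q else 0) - (if l = i then b k j p q else 0) =
      (if l = p then b i j k q else 0) - (if q = k then b i j p l else 0) := by
    intro i j k l p q
    have h := hi (single i j 1) (single k l 1) (single p q 1)
    simp only [← hb]
    convert h using 1
    all_goals
      simp only [hmul, map_sub, LinearMap.sub_apply]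
      split_ifs <;> simp
  have hdiag : ∀ i p j, p ≠ j → b i i p j = 0 := by
    intro i p j hpj
    have := hinv i i p p p j
    grind
  have hoff : ∀ i j p q, i ≠ j → b i j p q =
      if j = p ∧ i = q then b i i i i - b i i j j else 0 := by
    intro i j p q hij
    have := hinv i i i j p q
    grind
  have hswap : ∀ i j, b i j j i = b j i i j := fun i j => hsymm _ _ _ _
  have hrow : ∀ i j k, i ≠ j → i ≠ k → b i j j i = b i k k i := by
    intro i j k hij hik
    have := hinv i k k j j i
    grind
  have hconst : ∀ i j, i ≠ j → b i j j i = b u v v u := by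
    intro i j hij
    by_cases hiu : i = u
    · subst hiu; exact hrow _ _ _ hij huv
    · rw [hrow i j u hij hiu, hswap, hrow u i v (Ne.symm hiu) huv]
  have hcorner : ∀ i j, b i i i i = b j j j j := by
    intro i j
    by_cases hij : i = j
    · rw [hij]
    · have h₁ := hoff i j j i hij
      have h₂ := hoff j i i j (Ne.symm hij)
      have h₃ := hswap i j
      have h₄ := hsymm i i j j
      grind
  have key : ∀ i j k l, b i j k l = b u v v u * (if j = k ∧ i = l then 1 else 0) +
      (b u u u u - b u v v u) * ((if i = j then 1 else 0) * (if k = l then 1 else 0)) := by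
    intro i j k l
    by_cases hij : i = j
    · subst hij
      by_cases hkl : k = l
      · subst hkl
        by_cases hik : i = k
        · subst hik; simp [hcorner i u]
        · have h₁ := hoff i k k i hik
          have h₂ := hconst i k hik
          have h₃ := hcorner i u
          grind
      · have := hdiag i k l hkl
        grind
    · have h₁ := hoff i j k l hij
      have h₂ := hoff i j j i hij
      have h₃ := hconst i j hij
      rw [h₁, if_neg hij]
      simp only [and_self, if_true] at h₂
      split_ifs <;> simp [← h₂, h₃]
  refine ⟨b u v v u, b u u u u - b u v v u, fun X Y => ?_⟩
  induction X using Matrix.induction_on' with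
  | h_zero => simp
  | h_add X₁ X₂ h₁ h₂ => simp only [map_add, LinearMap.add_apply, h₁, h₂, add_mul, trace_add]; ring
  | h_std_basis i j x =>
    induction Y using Matrix.induction_on' with
    | h_zero => simp
    | h_add Y₁ Y₂ h₁ h₂ => simp only [map_add, h₁, h₂, mul_add, trace_add]; ring
    | h_std_basis k l y =>
      have hx : single i j x = x • single i j (1 : R) := by simp
      have hy : single k l y = y • single k l (1 : R) := by simp
      rw [hx, hy]
      simp only [map_smul, LinearMap.smul_apply, hb, smul_eq_mul, trace_smul,
        smul_mul_assoc, mul_smul_comm]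
      have ht : ∀ p q : m, trace (single p q (1 : R)) = if p = q then 1 else 0 := by
        intro p q
        split_ifs with h
        · subst h; simp
        · exact trace_single_eq_of_ne _ _ _ h
      have hm : trace (single i j (1 : R) * single k l 1) = if j = k ∧ i = l then 1 else 0 := by
        rw [hmul]
        by_cases h : j = k <;> simp [h, ht]
      rw [key i j k l, hm, ht, ht]
      ring

end Matrix

namespace LieAlgebra.SpecialLinear

/-- The projection of matrices onto their trace-free part. -/
noncomputable def traceFreePart (m K : Type*) [Fintype m] [DecidableEq m] [Nonempty m] [Field K]
    [CharZero K] : Matrix m m K →ₗ[K] sl m K :=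
  (LinearMap.id - (Fintype.card m : K)⁻¹ •
    (Matrix.traceLinearMap m K K).smulRight (1 : Matrix m m K)).codRestrict _ fun X => by
      change Matrix.trace _ = 0
      simp [Matrix.trace_sub, Matrix.trace_smul, mul_comm]

variable {m K : Type*} [Fintype m] [DecidableEq m] [Nonempty m] [Field K] [CharZero K]

theorem val_traceFreePart (X : Matrix m m K) : (traceFreePart m K X).val =
    X - (Fintype.card m : K)⁻¹ • X.trace • (1 : Matrix m m K) := rfl

theorem traceFreePart_val (x : sl m K) : traceFreePart m K x.val = x := by
  have hx : x.val.trace = 0 := x.property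
  ext : 1
  simp [val_traceFreePart, hx]

theorem traceFreePart_commutator (X Y : Matrix m m K) : traceFreePart m K (X * Y - Y * X) =
    ⁅traceFreePart m K X, traceFreePart m K Y⁆ := by
  ext : 1
  rw [sl_bracket]
  simp only [val_traceFreePart, Matrix.trace_sub, Matrix.trace_mul_comm Y X, sub_self, zero_smul,
    smul_zero, sub_zero, mul_sub, sub_mul, smul_mul_assoc, mul_smul_comm, one_mul, mul_one]
  module

end LieAlgebra.SpecialLinear

/-- For `n ≥ 2`, every symmetric invariant bilinear form on `sl(n,ℂ)` is a
scalar multiple of the trace form `β(x,y) = tr(xy)`; the space of such forms is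
one-dimensional, spanned by `β`. -/
theorem sl_n_symmetric_invariant_bilinear_forms (n : ℕ) (hn : 2 ≤ n) :
    -- β is symmetric and invariant,
    (∀ x y : sl (Fin n) ℂ, Matrix.trace (x.val * y.val) = Matrix.trace (y.val * x.val)) ∧
    (∀ x y z : sl (Fin n) ℂ,
        Matrix.trace ((⁅x, y⁆ : sl (Fin n) ℂ).val * z.val)
          = Matrix.trace (x.val * (⁅y, z⁆ : sl (Fin n) ℂ).val)) ∧
    -- β is nonzero,
    (∃ x y : sl (Fin n) ℂ, Matrix.trace (x.val * y.val) ≠ 0) ∧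
    -- and every symmetric invariant bilinear form on sl(n,ℂ) is a scalar multiple of β.
    (∀ B : (sl (Fin n) ℂ) →ₗ[ℂ] (sl (Fin n) ℂ) →ₗ[ℂ] ℂ,
        (∀ x y : sl (Fin n) ℂ, B x y = B y x) →
        (∀ x y z : sl (Fin n) ℂ, B ⁅x, y⁆ z = B x ⁅y, z⁆) →
        ∃ c : ℂ, ∀ x y : sl (Fin n) ℂ, B x y = c * Matrix.trace (x.val * y.val)) := by
  have : Nontrivial (Fin n) := Fin.nontrivial_iff_two_le.mpr hn
  refine ⟨fun x y => Matrix.trace_mul_comm _ _, fun x y z => ?_, ?_, fun B hs hi => ?_⟩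
  · rw [sl_bracket, sl_bracket, sub_mul, mul_sub, Matrix.trace_sub, Matrix.trace_sub,
      Matrix.mul_assoc, Matrix.trace_mul_comm (y.val * x.val), ← Matrix.mul_assoc z.val,
      Matrix.trace_mul_comm (z.val * y.val)]
  · obtain ⟨i, j, hij⟩ := exists_pair_ne (Fin n)
    exact ⟨single i j hij 1, single j i hij.symm 1, by simp⟩
  · obtain ⟨c, d, h⟩ := Matrix.exists_eq_trace_mul_add_of_symm_of_invariant
      (B.compl₁₂ (traceFreePart (Fin n) ℂ) (traceFreePart (Fin n) ℂ))
      (fun X Y => hs _ _)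
      (fun X Y Z => by
        simp only [LinearMap.compl₁₂_apply, traceFreePart_commutator, hi])
    refine ⟨c, fun x y => ?_⟩
    have hx : x.val.trace = 0 := x.property
    simpa [LinearMap.compl₁₂_apply, traceFreePart_val, hx] using h x.val y.val
end
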